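/- Leaf-exchange lemma: let S be a spanning tree of a finite graph G, let v be an internal vertex of S, and let u be a leaf of S that is not a descendant of v (when S is rooted at some vertex r with v ≠ r). Suppose every child of v in S is adjacent in G to u. Then G has a spanning tree S' with at least as many leaves as S in which v is a leaf. -/

import Mathlib

/-- The graph of a parent map. -/
def parentGraph {V : Type*} (r : V) (p : V → V) : SimpleGraph V where
  Adj a b := a ≠ b ∧ ((a ≠ r ∧ p a = b) ∨ (b ≠ r ∧ p b = a))
  symm := ⟨fun _ _ h => ⟨h.1.symm, h.2.symm⟩⟩
  loopless := ⟨fun _ h => h.1 rfl⟩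

theorem parentGraph_isTree {V : Type*} [Fintype V] (r : V) (p : V → V)
    (hreach : ∀ w : V, ∃ n : ℕ, p^[n] w = r) : (parentGraph r p).IsTree := by
  classical
  have hr : ∀ n w, p^[n] w = r → (parentGraph r p).Reachable w r := by
    intro n
    induction n with
    | zero => intro w h; simp at h; rw [h]
    | succ n ih =>
      intro w h
      by_cases hw : w = r
      · rw [hw]
      have h2 := ih (p w) h
      by_cases hpw : w = p w
      · rw [← hpw] at h2; exact h2
      · exact (SimpleGraph.Adj.reachable (G := parentGraph r p)
          ⟨hpw, Or.inl ⟨hw, rfl⟩⟩).trans h2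
  have hc : (parentGraph r p).Connected := by
    have : Nonempty V := ⟨r⟩
    refine ⟨fun a b => ?_⟩
    obtain ⟨n, hn⟩ := hreach a
    obtain ⟨m, hm⟩ := hreach b
    exact (hr n a hn).trans (hr m b hm).symm
  rw [SimpleGraph.isTree_iff_connected_and_card]
  refine ⟨hc, le_antisymm ?_ hc.card_vert_le_card_edgeSet_add_one⟩
  have hsub : (parentGraph r p).edgeSet ⊆ (fun w => s(w, p w)) '' {w | w ≠ r} := by
    intro e
    induction e using Sym2.ind with
    | _ a b =>
      rintro ⟨_, ⟨h1, h2⟩ | ⟨h1, h2⟩⟩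
      · exact ⟨a, h1, by simp [h2]⟩
      · exact ⟨b, h1, by simp [h2, Sym2.eq_swap]⟩
  have h1 := Set.ncard_le_ncard hsub (Set.toFinite _)
  have h2 := Set.ncard_image_le (f := fun w => s(w, p w)) (Set.toFinite {w | w ≠ r})
  have h3 : ({w | w ≠ r} : Set V).ncard + 1 = Nat.card V := by
    have := Set.ncard_add_ncard_compl ({r} : Set V)
    rw [Set.ncard_singleton] at this
    have e : ({w | w ≠ r} : Set V) = {r}ᶜ := by ext; simp
    rw [e]; omega
  rw [Nat.card_coe_set_eq]
  omega

/-- leaf-exchange lemma. Let `S` be a spanning tree of `G`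
rooted at `r` (rooting given by the parent map `p`), let `v ≠ r` be an
internal vertex of `S`, and let `u` be a leaf of `S` not a descendant of `v`
such that every child of `v` is adjacent in `G` to `u`. Then `G` has a
spanning tree with at least as many leaves as `S` in which `v` is a leaf. -/
theorem stmt_15 {V : Type*} [Fintype V] (G S : SimpleGraph V)
    (hSG : S ≤ G) (hS : S.IsTree)
    (r : V) (p : V → V) (hpr : p r = r)
    (hpadj : ∀ w : V, w ≠ r → S.Adj w (p w))
    (hreach : ∀ w : V, ∃ n : ℕ, p^[n] w = r)
    (v : V) (hvr : v ≠ r) (hvint : (S.neighborSet v).ncard ≠ 1)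
    (u : V) (hu : (S.neighborSet u).ncard = 1)
    (hnotdesc : ∀ n : ℕ, p^[n] u ≠ v)
    (hchild : ∀ w : V, w ≠ r → p w = v → G.Adj w u) :
    ∃ S' : SimpleGraph V, S' ≤ G ∧ S'.IsTree ∧
      (S'.neighborSet v).ncard = 1 ∧
      {x : V | (S.neighborSet x).ncard = 1}.ncard ≤
        {x : V | (S'.neighborSet x).ncard = 1}.ncard := by
  classical
  have hT := parentGraph_isTree r p hreach
  have hTS : parentGraph r p ≤ S := by
    rintro a b ⟨_, ⟨h1, h2⟩ | ⟨h1, h2⟩⟩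
    · exact h2 ▸ hpadj a h1
    · exact h2 ▸ (hpadj b h1).symm
  have hEq : parentGraph r p = S := by
    have c1 := (SimpleGraph.isTree_iff_connected_and_card.1 hT).2
    have c2 := (SimpleGraph.isTree_iff_connected_and_card.1 hS).2
    rw [Nat.card_coe_set_eq] at c1 c2
    apply SimpleGraph.edgeSet_injective
    exact Set.eq_of_subset_of_ncard_le (SimpleGraph.edgeSet_mono hTS) (by omega)
      (Set.toFinite _)
  have hadj : ∀ a b, S.Adj a b ↔ (a ≠ b ∧ ((a ≠ r ∧ p a = b) ∨ (b ≠ r ∧ p b = a))) := by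
    intro a b; rw [← hEq]; rfl
  have huv : u ≠ v := hnotdesc 0
  have hpu : p u ≠ v := hnotdesc 1
  have hppu : p (p u) ≠ v := hnotdesc 2
  have hne : ∀ w, w ≠ r → p w ≠ w := fun w hw => (hpadj w hw).ne'
  have hcyc : ∀ x, p x = v → p v ≠ x := by
    intro x hx hv
    have hxr : x ≠ r := by rintro rfl; exact hvr (hx.symm.trans hpr)
    have : ∀ n, p^[n] v = v ∨ p^[n] v = x := by
      intro n
      induction n with
      | zero => simp
      | succ n ih =>
        rw [Function.iterate_succ_apply']
        rcases ih with h | h <;> rw [h]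
        · exact Or.inr hv
        · exact Or.inl hx
    obtain ⟨n, hn⟩ := hreach v
    rcases this n with h | h
    · exact hvr (h.symm.trans hn)
    · exact hxr (h.symm.trans hn)
  let q : V → V := fun w => if p w = v then u else p w
  have hq1 : ∀ w, p w = v → q w = u := fun w h => if_pos h
  have hq2 : ∀ w, p w ≠ v → q w = p w := fun w h => if_neg h
  have hqu : ∀ n, q^[n] u = p^[n] u := by
    intro n
    induction n with
    | zero => rfl
    | succ n ih =>
      rw [Function.iterate_succ_apply', ih, Function.iterate_succ_apply', hq2]
      rw [← Function.iterate_succ_apply' p n u]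
      exact hnotdesc _
  have hqreach : ∀ w, ∃ n, q^[n] w = r := by
    have : ∀ n w, p^[n] w = r → ∃ n, q^[n] w = r := by
      intro n
      induction n with
      | zero => intro w h; exact ⟨0, h⟩
      | succ n ih =>
        intro w h
        by_cases hw : p w = v
        · obtain ⟨m, hm⟩ := hreach u
          refine ⟨m + 1, ?_⟩
          rw [Function.iterate_succ_apply, hq1 w hw, hqu, hm]
        · obtain ⟨m, hm⟩ := ih (p w) h
          refine ⟨m + 1, ?_⟩
          rw [Function.iterate_succ_apply, hq2 w hw, hm]
    intro w
    obtain ⟨n, hn⟩ := hreach w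
    exact this n w hn
  have hadj' : ∀ a b, (parentGraph r q).Adj a b ↔
      (a ≠ b ∧ ((a ≠ r ∧ q a = b) ∨ (b ≠ r ∧ q b = a))) := fun _ _ => Iff.rfl
  have hqG : ∀ w, w ≠ r → G.Adj w (q w) := by
    intro w hw
    by_cases h : p w = v
    · rw [hq1 w h]; exact hchild w hw h
    · rw [hq2 w h]; exact hSG (hpadj w hw)
  have hvleaf : ((parentGraph r q).neighborSet v).ncard = 1 := by
    rw [Set.ncard_eq_one]
    refine ⟨p v, ?_⟩
    ext b
    simp only [SimpleGraph.mem_neighborSet, hadj', Set.mem_singleton_iff]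
    have := hne v hvr
    have h2 := hq2 v this
    have h3 : q b ≠ v := by
      by_cases h : p b = v
      · rw [hq1 b h]; exact huv
      · rw [hq2 b h]; exact h
    grind
  refine ⟨parentGraph r q, ?_, parentGraph_isTree r q hqreach, hvleaf, ?_⟩
  · rintro a b ⟨_, ⟨h1, h2⟩ | ⟨h1, h2⟩⟩
    · exact h2 ▸ hqG a h1
    · exact h2 ▸ (hqG b h1).symm
  have hkey : ∀ x, x ≠ u → (S.neighborSet x).ncard = 1 →
      ((parentGraph r q).neighborSet x).ncard = 1 := by
    intro x hxu hx
    have hxv : x ≠ v := by rintro rfl; exact hvint hx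
    have hqx : ∀ b, q b = x ↔ p b = x := by
      intro b
      by_cases h : p b = v
      · rw [hq1 b h, h]; exact ⟨fun h => absurd h.symm hxu, fun h => absurd h.symm hxv⟩
      · rw [hq2 b h]
    by_cases hpx : p x = v
    · have hxr : x ≠ r := by rintro rfl; exact hvr (hpx.symm.trans hpr)
      obtain ⟨a, ha⟩ := Set.ncard_eq_one.1 hx
      have hm : ∀ b, S.Adj x b ↔ b = a := by
        intro b
        rw [← SimpleGraph.mem_neighborSet, ha]; rfl
      have hav : v = a := (hm v).1 (hpx ▸ hpadj x hxr)
      subst hav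
      rw [Set.ncard_eq_one]
      refine ⟨u, ?_⟩
      ext b
      simp only [SimpleGraph.mem_neighborSet, hadj', Set.mem_singleton_iff, hqx, hq1 x hpx]
      have h1 := hm b
      rw [hadj] at h1
      have h2 := hcyc x hpx
      grind
    · have : (parentGraph r q).neighborSet x = S.neighborSet x := by
        ext b
        simp only [SimpleGraph.mem_neighborSet, hadj', hadj, hqx, hq2 x hpx]
      rw [this]; exact hx
  have hsub : insert v ({x : V | (S.neighborSet x).ncard = 1} \ {u}) ⊆
      {x : V | ((parentGraph r q).neighborSet x).ncard = 1} := by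
    rintro x (rfl | ⟨h1, h2⟩)
    · exact hvleaf
    · exact hkey x h2 h1
  have h1 := Set.ncard_le_ncard hsub (Set.toFinite _)
  rw [Set.ncard_insert_of_notMem (fun h => hvint h.1) (Set.toFinite _),
    Set.ncard_sdiff_singleton_add_one (by exact hu) (Set.toFinite _)] at h1
  exact h1
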